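/- Let t = (t_1,…,t_n) and z = (z_1,…,z_m) be real numbers with ∑_{i=1}^n t_i² > ∑_{j=1}^m z_j², and define, for y in a punctured right neighborhood of 0, E₊(y) = (−Q(y) + √(P(y)²+Q(y)²−1))/(1+P(y)) and E₋(y) = (−Q(y) − √(P(y)²+Q(y)²−1))/(1+P(y)) (these are well-defined and real for y > 0 small, since P(y)²+Q(y)²−1 ≥ 0 near 0 and 1+P(0) = 2). Then lim_{y→0⁺} E₊(y)/y = (−e₁(t)+e₁(z))/2 + (1/2)√(e₁(t)² − 2e₂(t) − e₁(z)² + 2e₂(z)) and lim_{y→0⁺} E₋(y)/y = (−e₁(t)+e₁(z))/2 − (1/2)√(e₁(t)² − 2e₂(t) − e₁(z)² + 2e₂(z)). -/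

import Mathlib

/-- The `k`-th elementary symmetric polynomial of the reals `t 0, …, t (n-1)`. -/
noncomputable def esymm {n : ℕ} (t : Fin n → ℝ) (k : ℕ) : ℝ :=
  ∑ s ∈ (Finset.univ : Finset (Fin n)).powersetCard k, ∏ i ∈ s, t i

/-- `P(y) = Re[∏ᵢ(1+i tᵢ y)/∏ⱼ(1+i zⱼ y)]`. -/
noncomputable def Pfun {n m : ℕ} (t : Fin n → ℝ) (z : Fin m → ℝ) (y : ℝ) : ℝ :=
  ((∏ i, (1 + Complex.I * (t i : ℂ) * (y : ℂ))) /
    (∏ j, (1 + Complex.I * (z j : ℂ) * (y : ℂ)))).re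

/-- `Q(y) = Im[∏ᵢ(1+i tᵢ y)/∏ⱼ(1+i zⱼ y)]`. -/
noncomputable def Qfun {n m : ℕ} (t : Fin n → ℝ) (z : Fin m → ℝ) (y : ℝ) : ℝ :=
  ((∏ i, (1 + Complex.I * (t i : ℂ) * (y : ℂ))) /
    (∏ j, (1 + Complex.I * (z j : ℂ) * (y : ℂ)))).im

/-- The branch `E₊(y)` of `E(y)` (plus sign in the paper's eq. (2.14)). -/
noncomputable def Eplus {n m : ℕ} (t : Fin n → ℝ) (z : Fin m → ℝ) (y : ℝ) : ℝ :=
  (-Qfun t z y + Real.sqrt (Pfun t z y ^ 2 + Qfun t z y ^ 2 - 1)) / (1 + Pfun t z y)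

/-- The branch `E₋(y)` of `E(y)` (minus sign in the paper's eq. (2.14)). -/
noncomputable def Eminus {n m : ℕ} (t : Fin n → ℝ) (z : Fin m → ℝ) (y : ℝ) : ℝ :=
  (-Qfun t z y - Real.sqrt (Pfun t z y ^ 2 + Qfun t z y ^ 2 - 1)) / (1 + Pfun t z y)

lemma Finset.sum_powersetCard_one_prod {ι R : Type*} [CommRing R] (s : Finset ι) (f : ι → R) :
    ∑ u ∈ s.powersetCard 1, ∏ i ∈ u, f i = ∑ i ∈ s, f i := by
  simp [Finset.powersetCard_one]

lemma Finset.sq_sum_sub_two_mul_sum_powersetCard_two {ι R : Type*} [CommRing R]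
    (s : Finset ι) (f : ι → R) :
    (∑ i ∈ s, f i) ^ 2 - 2 * ∑ u ∈ s.powersetCard 2, ∏ i ∈ u, f i = ∑ i ∈ s, f i ^ 2 := by
  classical
  induction s using Finset.induction_on with
  | empty => simp [Finset.powersetCard_eq_empty.2 (show (∅ : Finset ι).card < 2 by simp)]
  | insert a s ha ih =>
    have hmem : ∀ k, ∀ u ∈ s.powersetCard k, a ∉ u := fun k u hu hau =>
      ha ((Finset.mem_powersetCard.1 hu).1 hau)
    rw [Finset.powersetCard_succ_insert ha, Finset.sum_union, Finset.sum_image,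
      Finset.sum_congr rfl fun u hu => Finset.prod_insert (hmem 1 u hu), ← Finset.mul_sum,
      Finset.sum_powersetCard_one_prod, Finset.sum_insert ha, Finset.sum_insert ha, ← ih]
    · ring
    · intro u hu v hv huv
      rw [← Finset.erase_insert (hmem 1 u hu), ← Finset.erase_insert (hmem 1 v hv), huv]
    · refine Finset.disjoint_left.2 fun u hu hu' => ?_
      obtain ⟨v, -, rfl⟩ := Finset.mem_image.1 hu'
      exact hmem 2 _ hu (Finset.mem_insert_self a v)

lemma esymm_one {n : ℕ} (t : Fin n → ℝ) : esymm t 1 = ∑ i, t i :=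
  Finset.sum_powersetCard_one_prod _ _

lemma esymm_one_sq_sub_two_mul_esymm_two {n : ℕ} (t : Fin n → ℝ) :
    esymm t 1 ^ 2 - 2 * esymm t 2 = ∑ i, t i ^ 2 := by
  rw [esymm_one, esymm, Finset.sq_sum_sub_two_mul_sum_powersetCard_two]

lemma hasDerivAt_prod_one_add_mul_zero {ι 𝕜 : Type*} [NontriviallyNormedField 𝕜]
    (s : Finset ι) (c : ι → 𝕜) :
    HasDerivAt (fun x : 𝕜 => ∏ i ∈ s, (1 + c i * x)) (∑ i ∈ s, c i) 0 := by
  classical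
  have h := HasDerivAt.fun_finsetProd (u := s) (x := (0 : 𝕜))
    (f := fun i x => 1 + c i * x) (f' := c)
    fun i _ => by simpa using ((hasDerivAt_id (0 : 𝕜)).const_mul (c i)).const_add 1
  simpa using h

lemma hasDerivAt_prod_div_prod_zero {ι κ 𝕜 : Type*} [NontriviallyNormedField 𝕜]
    (s : Finset ι) (u : Finset κ) (c : ι → 𝕜) (d : κ → 𝕜) :
    HasDerivAt (fun x : 𝕜 => (∏ i ∈ s, (1 + c i * x)) / ∏ j ∈ u, (1 + d j * x))
      (∑ i ∈ s, c i - ∑ j ∈ u, d j) 0 := by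
  simpa using (hasDerivAt_prod_one_add_mul_zero s c).fun_div
    (hasDerivAt_prod_one_add_mul_zero u d) (by simp)

lemma hasDerivAt_ratio_zero {n m : ℕ} (t : Fin n → ℝ) (z : Fin m → ℝ) :
    HasDerivAt (fun y : ℝ => (∏ i, (1 + Complex.I * (t i : ℂ) * (y : ℂ))) /
      (∏ j, (1 + Complex.I * (z j : ℂ) * (y : ℂ))))
      (∑ i, Complex.I * (t i : ℂ) - ∑ j, Complex.I * (z j : ℂ)) 0 :=
  HasDerivAt.comp_ofReal (z := 0) (by
    simpa using hasDerivAt_prod_div_prod_zero Finset.univ Finset.univ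
      (fun i => Complex.I * (t i : ℂ)) (fun j => Complex.I * (z j : ℂ)))

lemma tendsto_Pfun_zero {n m : ℕ} (t : Fin n → ℝ) (z : Fin m → ℝ) :
    Filter.Tendsto (Pfun t z) (nhds 0) (nhds 1) := by
  simpa [Function.comp_def, ← Pfun.eq_def] using
    (Complex.continuous_re.continuousAt.comp (hasDerivAt_ratio_zero t z).continuousAt).tendsto

lemma tendsto_Qfun_div_zero {n m : ℕ} (t : Fin n → ℝ) (z : Fin m → ℝ) :
    Filter.Tendsto (fun y => Qfun t z y / y) (nhdsWithin 0 (Set.Ioi 0))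
      (nhds (esymm t 1 - esymm z 1)) := by
  have h : HasDerivAt (Qfun t z) (esymm t 1 - esymm z 1) 0 := by
    have := Complex.imCLM.hasFDerivAt.comp_hasDerivAt (0 : ℝ) (hasDerivAt_ratio_zero t z)
    simpa [esymm_one, Function.comp_def, ← Qfun.eq_def] using this
  simpa [div_eq_inv_mul, Qfun] using h.tendsto_slope_zero_right

lemma Pfun_sq_add_Qfun_sq {n m : ℕ} (t : Fin n → ℝ) (z : Fin m → ℝ) (y : ℝ) :
    Pfun t z y ^ 2 + Qfun t z y ^ 2 =
      (∏ i, (1 + t i ^ 2 * y ^ 2)) / ∏ j, (1 + z j ^ 2 * y ^ 2) := by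
  have h : ∀ a : ℝ, Complex.normSq (1 + Complex.I * (a : ℂ) * (y : ℂ)) = 1 + a ^ 2 * y ^ 2 := by
    intro a
    simp [Complex.normSq_apply]
    ring
  rw [Pfun, Qfun, sq, sq, ← Complex.normSq_apply, map_div₀, map_prod, map_prod]
  simp only [h]

lemma tendsto_sqrt_div_zero {n m : ℕ} (t : Fin n → ℝ) (z : Fin m → ℝ) :
    Filter.Tendsto (fun y => Real.sqrt (Pfun t z y ^ 2 + Qfun t z y ^ 2 - 1) / y)
      (nhdsWithin 0 (Set.Ioi 0))
      (nhds (Real.sqrt (∑ i, t i ^ 2 - ∑ j, z j ^ 2))) := by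
  have hslope := (hasDerivAt_prod_div_prod_zero Finset.univ Finset.univ
    (fun i => t i ^ 2) (fun j => z j ^ 2)).tendsto_slope_zero_right
  have hsq : Filter.Tendsto (fun y : ℝ => y ^ 2) (nhdsWithin 0 (Set.Ioi 0))
      (nhdsWithin 0 (Set.Ioi 0)) := by
    refine tendsto_nhdsWithin_iff.2 ⟨?_, ?_⟩
    · have : Filter.Tendsto (fun y : ℝ => y ^ 2) (nhds 0) (nhds 0) := by
        simpa using (continuous_pow 2).tendsto (0 : ℝ)
      exact this.mono_left nhdsWithin_le_nhds
    · filter_upwards [self_mem_nhdsWithin] with y hy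
      exact pow_pos (Set.mem_Ioi.1 hy) 2
  refine ((Real.continuous_sqrt.tendsto _).comp (hslope.comp hsq)).congr' ?_
  filter_upwards [self_mem_nhdsWithin] with y hy
  have hy : 0 < y := hy
  rw [Pfun_sq_add_Qfun_sq]
  simp only [Function.comp_apply, zero_add, mul_zero, add_zero, Finset.prod_const_one, div_one,
    smul_eq_mul]
  rw [← div_eq_inv_mul, Real.sqrt_div' _ (sq_nonneg y), Real.sqrt_sq hy.le]

/-- paper's eq. (2.15). If `∑ tᵢ² > ∑ zⱼ²`, the branches `E₊, E₋`
of `E` have derivatives at `0` (from the right) given by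
`(−e₁(t)+e₁(z))/2 ± (1/2)√(e₁(t)² − 2e₂(t) − e₁(z)² + 2e₂(z))`. -/
theorem deriv_Eplus_Eminus_at_zero (n m : ℕ) (t : Fin n → ℝ) (z : Fin m → ℝ)
    (hsum : ∑ i, t i ^ 2 > ∑ j, z j ^ 2) :
    Filter.Tendsto (fun y : ℝ => Eplus t z y / y) (nhdsWithin 0 (Set.Ioi 0))
      (nhds ((-esymm t 1 + esymm z 1) / 2 +
        (1 / 2) * Real.sqrt (esymm t 1 ^ 2 - 2 * esymm t 2 - esymm z 1 ^ 2 + 2 * esymm z 2))) ∧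
    Filter.Tendsto (fun y : ℝ => Eminus t z y / y) (nhdsWithin 0 (Set.Ioi 0))
      (nhds ((-esymm t 1 + esymm z 1) / 2 -
        (1 / 2) * Real.sqrt (esymm t 1 ^ 2 - 2 * esymm t 2 - esymm z 1 ^ 2 + 2 * esymm z 2))) := by
  have hP : Filter.Tendsto (fun y => 1 + Pfun t z y) (nhdsWithin 0 (Set.Ioi 0)) (nhds (1 + 1)) :=
    ((tendsto_Pfun_zero t z).mono_left nhdsWithin_le_nhds).const_add 1
  have hQ := (tendsto_Qfun_div_zero t z).neg
  have hS := tendsto_sqrt_div_zero t z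
  have hrad : esymm t 1 ^ 2 - 2 * esymm t 2 - esymm z 1 ^ 2 + 2 * esymm z 2 =
      ∑ i, t i ^ 2 - ∑ j, z j ^ 2 := by
    rw [← esymm_one_sq_sub_two_mul_esymm_two, ← esymm_one_sq_sub_two_mul_esymm_two]
    ring
  rw [hrad]
  constructor
  · convert (hQ.add hS).div hP (by norm_num) using 2
    · simp only [Eplus, Pi.div_apply]
      ring
    · ring
  · convert (hQ.sub hS).div hP (by norm_num) using 2
    · simp only [Eminus, Pi.div_apply]
      ring
    · ring
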